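/- arXiv:2411.15932 — 3 statements merged into one kernel-verified Lean document; each statement's English description precedes it below -/
import Mathlib

section
/- For every real γ > 0, every r with 0 < r < 1, and every s with 0 ≤ s ≤ π r, the map Φ(r,s) = (r, S(r,s)) is differentiable at (r,s) and the operator norm of its total derivative DΦ(r,s) satisfies 1 < ‖DΦ(r,s)‖ ≤ ( 1 + (γ+1)² π⁴/(π−1)⁴ + 1/(π−1)² )^{1/2}. -/
open Real

/-- The natural reflection `Φ(r,s) = (r, r^γ (π r − s)/(π − r^γ))` of the exterior of the
two-dimensional outward cuspidal domain with `γ`-cusp onto the cusp, written in the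
infinitesimally orthonormal coordinates `(r,s)`. -/
noncomputable def cuspReflection (γ : ℝ) :
    EuclideanSpace ℝ (Fin 2) → EuclideanSpace ℝ (Fin 2) := fun x =>
  (WithLp.equiv 2 (Fin 2 → ℝ)).symm
    ![x 0, x 0 ^ γ * (Real.pi * x 0 - x 1) / (Real.pi - x 0 ^ γ)]

/-- The total derivative of `cuspReflection`, described by its two components. -/
theorem hasFDerivAt_cuspReflection {γ r s : ℝ} (hr : 0 < r) (hp : Real.pi - r ^ γ ≠ 0) :
    ∃ L : EuclideanSpace ℝ (Fin 2) →L[ℝ] EuclideanSpace ℝ (Fin 2),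
      HasFDerivAt (cuspReflection γ) L ((WithLp.equiv 2 (Fin 2 → ℝ)).symm ![r, s]) ∧
      ∀ v, L v 0 = v 0 ∧
        L v 1 = (Real.pi * r ^ γ / (Real.pi - r ^ γ) +
          γ * r ^ γ * ((Real.pi * r - s) / r) * Real.pi / (Real.pi - r ^ γ) ^ 2) * v 0 -
          r ^ γ / (Real.pi - r ^ γ) * v 1 := by
  set x : EuclideanSpace ℝ (Fin 2) := (WithLp.equiv 2 (Fin 2 → ℝ)).symm ![r, s]
  have hx0 : x 0 = r := rfl
  have hx1 : x 1 = s := rfl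
  have h0 : HasFDerivAt (fun y : EuclideanSpace ℝ (Fin 2) => y 0)
      (EuclideanSpace.proj 0 : EuclideanSpace ℝ (Fin 2) →L[ℝ] ℝ) x :=
    (EuclideanSpace.proj 0 : EuclideanSpace ℝ (Fin 2) →L[ℝ] ℝ).hasFDerivAt
  have h1 : HasFDerivAt (fun y : EuclideanSpace ℝ (Fin 2) => y 1)
      (EuclideanSpace.proj 1 : EuclideanSpace ℝ (Fin 2) →L[ℝ] ℝ) x :=
    (EuclideanSpace.proj 1 : EuclideanSpace ℝ (Fin 2) →L[ℝ] ℝ).hasFDerivAt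
  have hpow : HasDerivAt (fun t : ℝ => t ^ γ) (γ * r ^ γ / r) (x 0) := by
    have h := Real.hasDerivAt_rpow_const (x := r) (p := γ) (Or.inl hr.ne')
    rwa [Real.rpow_sub_one hr.ne', ← mul_div_assoc] at h
  have hf := (hpow.fun_div (hpow.const_sub Real.pi) hp).comp_hasFDerivAt x h0
  have hS := hf.mul ((h0.const_mul Real.pi).sub h1)
  have hS₁ := hS.congr_of_eventuallyEq (f₁ := fun y => cuspReflection γ y 1)
    (.of_forall fun y => mul_div_right_comm _ _ _)
  have hcomp : ∀ i, DifferentiableAt ℝ (fun y => cuspReflection γ y i) x :=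
    Fin.forall_fin_two.2 ⟨h0.differentiableAt, hS₁.differentiableAt⟩
  have hΦ := (differentiableAt_euclidean.2 hcomp).hasFDerivAt
  have hproj (i : Fin 2) : HasFDerivAt (fun y => cuspReflection γ y i)
      ((EuclideanSpace.proj i).comp (fderiv ℝ (cuspReflection γ) x)) x :=
    (EuclideanSpace.proj i : EuclideanSpace ℝ (Fin 2) →L[ℝ] ℝ).hasFDerivAt.comp x hΦ
  refine ⟨_, hΦ, fun v => ⟨DFunLike.congr_fun ((hproj 0).unique h0) v, ?_⟩⟩
  refine (DFunLike.congr_fun ((hproj 1).unique hS₁) v).trans ?_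
  simp [hx0, hx1]
  field_simp
  ring

/-- For every real `γ > 0`, `0 < r < 1` and `0 ≤ s ≤ π r`, the map `Φ(r,s) = (r, S(r,s))`
is differentiable at `(r,s)` and the operator norm of its total derivative satisfies
`1 < ‖DΦ(r,s)‖ ≤ (1 + (γ+1)² π⁴/(π−1)⁴ + 1/(π−1)²)^{1/2}`. -/
theorem cusp_reflection_differentiable_norm_bound (γ : ℝ) (hγ : 0 < γ)
    (r s : ℝ) (hr0 : 0 < r) (hr1 : r < 1) (hs0 : 0 ≤ s) (hs1 : s ≤ Real.pi * r) :
    DifferentiableAt ℝ (cuspReflection γ) ((WithLp.equiv 2 (Fin 2 → ℝ)).symm ![r, s]) ∧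
    1 < ‖fderiv ℝ (cuspReflection γ) ((WithLp.equiv 2 (Fin 2 → ℝ)).symm ![r, s])‖ ∧
    ‖fderiv ℝ (cuspReflection γ) ((WithLp.equiv 2 (Fin 2 → ℝ)).symm ![r, s])‖ ≤
      (1 + (γ + 1) ^ 2 * Real.pi ^ 4 / (Real.pi - 1) ^ 4 + 1 / (Real.pi - 1) ^ 2) ^ ((1 : ℝ) / 2) := by
  have hπ := Real.pi_gt_three
  have hp0 : 0 < r ^ γ := Real.rpow_pos_of_pos hr0 γ
  have hp1 : r ^ γ < 1 := Real.rpow_lt_one hr0.le hr1 hγ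
  obtain ⟨L, hL, hLv⟩ := hasFDerivAt_cuspReflection (γ := γ) (s := s) hr0 (by linarith)
  refine ⟨hL.differentiableAt, ?_⟩
  rw [hL.fderiv]
  have hq0 : 0 ≤ (Real.pi * r - s) / r := div_nonneg (by linarith) hr0.le
  have hq1 : (Real.pi * r - s) / r ≤ Real.pi := by
    rw [div_le_iff₀ hr0]; linarith
  generalize (Real.pi * r - s) / r = q at *
  generalize r ^ γ = p at *
  have hd : 0 < Real.pi - p := by linarith
  have hd1 : 0 < Real.pi - 1 := by linarith
  have ha0 : 0 < Real.pi * p / (Real.pi - p) + γ * p * q * Real.pi / (Real.pi - p) ^ 2 := by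
    positivity
  have ha1 : Real.pi * p / (Real.pi - p) + γ * p * q * Real.pi / (Real.pi - p) ^ 2 ≤
      (γ + 1) * Real.pi ^ 2 / (Real.pi - 1) ^ 2 := by
    have e1 : Real.pi * p / (Real.pi - p) ≤ Real.pi ^ 2 / (Real.pi - 1) ^ 2 := by
      calc Real.pi * p / (Real.pi - p) ≤ Real.pi * 1 / (Real.pi - 1) := by gcongr
        _ ≤ Real.pi ^ 2 / (Real.pi - 1) ^ 2 := by
          rw [div_le_div_iff₀ hd1 (by positivity)]
          nlinarith [mul_pos Real.pi_pos hd1]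
    have e2 : γ * p * q * Real.pi / (Real.pi - p) ^ 2 ≤
        γ * 1 * Real.pi * Real.pi / (Real.pi - 1) ^ 2 := by gcongr
    calc _ ≤ _ := add_le_add e1 e2
      _ = _ := by ring
  have hb0 : 0 ≤ p / (Real.pi - p) := by positivity
  have hb1 : p / (Real.pi - p) ≤ 1 / (Real.pi - 1) := by gcongr
  generalize Real.pi * p / (Real.pi - p) + γ * p * q * Real.pi / (Real.pi - p) ^ 2 = a at *
  generalize p / (Real.pi - p) = b at *
  constructor
  · have h := L.le_opNorm (EuclideanSpace.single 0 1)
    rw [PiLp.norm_single, norm_one, mul_one] at h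
    refine lt_of_lt_of_le ?_ h
    rw [EuclideanSpace.norm_eq, Real.lt_sqrt zero_le_one]
    simp [Fin.sum_univ_two, hLv]
    positivity
  · rw [← Real.sqrt_eq_rpow]
    refine L.opNorm_le_bound (Real.sqrt_nonneg _) fun v => ?_
    rw [EuclideanSpace.norm_eq, EuclideanSpace.norm_eq, ← Real.sqrt_mul (by positivity)]
    apply Real.sqrt_le_sqrt
    simp only [Fin.sum_univ_two, (hLv v).1, (hLv v).2, Real.norm_eq_abs, sq_abs]
    calc v 0 ^ 2 + (a * v 0 - b * v 1) ^ 2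
        ≤ (1 + a ^ 2 + b ^ 2) * (v 0 ^ 2 + v 1 ^ 2) := by
          nlinarith [sq_nonneg (a * v 1 + b * v 0), sq_nonneg (v 1)]
      _ ≤ (1 + ((γ + 1) * Real.pi ^ 2 / (Real.pi - 1) ^ 2) ^ 2 + (1 / (Real.pi - 1)) ^ 2) *
          (v 0 ^ 2 + v 1 ^ 2) := by gcongr
      _ = _ := by rw [div_pow, div_pow, mul_pow, ← pow_mul, ← pow_mul, one_pow]
end

section
/- Let γ > 0 and p ≥ 1 be real numbers and let α satisfy 1/p ≤ α < 2/(γ + 2). Then the (p, αp)-dilatation integrand of the cuspidal reflection is integrable over U = {(r,s) ∈ ℝ² : 0 < r < 1, 0 < s < π r} and ∫∫_U ( ‖DΦ(r,s)‖^p / |det DΦ(r,s)| )^{α/(1−α)} ds dr ≤ π C_γ^{α/(1−α)} (1−α)/( 2(1−α) − αγ ) < ∞, where C_γ = π ( 1 + (γ+1)² π⁴/(π−1)⁴ + 1/(π−1)² )^{p/2}. -/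
open MeasureTheory Real

/-- The linear map `v ↦ (v₀, a v₀ + b v₁)` of the plane. -/
noncomputable def lowerShear (a b : ℝ) :
    EuclideanSpace ℝ (Fin 2) →L[ℝ] EuclideanSpace ℝ (Fin 2) :=
  Matrix.toEuclideanCLM (n := Fin 2) (𝕜 := ℝ) !![1, 0; a, b]

lemma lowerShear_apply_zero (a b : ℝ) (v : EuclideanSpace ℝ (Fin 2)) :
    lowerShear a b v 0 = v 0 := by
  simp [lowerShear, Matrix.ofLp_toEuclideanCLM, Matrix.mulVec, dotProduct]

lemma lowerShear_apply_one (a b : ℝ) (v : EuclideanSpace ℝ (Fin 2)) :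
    lowerShear a b v 1 = a * v 0 + b * v 1 := by
  simp [lowerShear, Matrix.ofLp_toEuclideanCLM, Matrix.mulVec, dotProduct]

lemma det_lowerShear (a b : ℝ) : LinearMap.det (lowerShear a b).toLinearMap = b := by
  have h : (lowerShear a b).toLinearMap = Matrix.toLin (EuclideanSpace.basisFun (Fin 2) ℝ).toBasis
      (EuclideanSpace.basisFun (Fin 2) ℝ).toBasis !![1, 0; a, b] := rfl
  rw [h, LinearMap.det_toLin]
  simp [Matrix.det_fin_two]

lemma norm_lowerShear_le (a b : ℝ) : ‖lowerShear a b‖ ≤ √(1 + a ^ 2 + b ^ 2) := by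
  refine ContinuousLinearMap.opNorm_le_bound _ (Real.sqrt_nonneg _) fun v => ?_
  rw [EuclideanSpace.norm_eq, EuclideanSpace.norm_eq, ← Real.sqrt_mul (by positivity)]
  refine Real.sqrt_le_sqrt ?_
  simp only [Fin.sum_univ_two, lowerShear_apply_zero, lowerShear_apply_one, Real.norm_eq_abs,
    sq_abs]
  nlinarith [sq_nonneg (a * v 1 - b * v 0), sq_nonneg (v 1)]

lemma hasFDerivAt_cuspReflection_s8 {γ : ℝ} {x : EuclideanSpace ℝ (Fin 2)} (hx : 0 < x 0)
    (hne : Real.pi - x 0 ^ γ ≠ 0) :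
    HasFDerivAt (cuspReflection γ)
      (lowerShear
        (γ * x 0 ^ (γ - 1) * (Real.pi * x 0 - x 1) * Real.pi / (Real.pi - x 0 ^ γ) ^ 2 +
          Real.pi * x 0 ^ γ / (Real.pi - x 0 ^ γ))
        (-(x 0 ^ γ / (Real.pi - x 0 ^ γ)))) x := by
  rw [← hasFDerivWithinAt_univ, hasFDerivWithinAt_piLp]
  simp only [hasFDerivWithinAt_univ]
  have h0 : HasFDerivAt (fun y : EuclideanSpace ℝ (Fin 2) => y 0)
      (EuclideanSpace.proj 0 : EuclideanSpace ℝ (Fin 2) →L[ℝ] ℝ) x :=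
    (EuclideanSpace.proj 0 : EuclideanSpace ℝ (Fin 2) →L[ℝ] ℝ).hasFDerivAt
  have h1 : HasFDerivAt (fun y : EuclideanSpace ℝ (Fin 2) => y 1)
      (EuclideanSpace.proj 1 : EuclideanSpace ℝ (Fin 2) →L[ℝ] ℝ) x :=
    (EuclideanSpace.proj 1 : EuclideanSpace ℝ (Fin 2) →L[ℝ] ℝ).hasFDerivAt
  have hpow := (Real.hasDerivAt_rpow_const (p := γ) (Or.inl hx.ne')).comp_hasFDerivAt x h0
  intro i
  fin_cases i
  · refine h0.congr_fderiv ?_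
    ext v
    simp [lowerShear_apply_zero]
  · have hinv := (hasDerivAt_inv hne).comp_hasFDerivAt x (hpow.const_sub Real.pi)
    refine ((hpow.mul ((h0.const_mul Real.pi).sub h1)).mul hinv).congr_fderiv ?_
    ext v
    simp [lowerShear_apply_one]
    field_simp
    ring

lemma dilatation_cuspReflection_le {γ p : ℝ} (hγ : 0 < γ) (hp : 0 ≤ p)
    {x : EuclideanSpace ℝ (Fin 2)} (h0 : 0 < x 0) (h0' : x 0 < 1) (h1 : 0 < x 1)
    (h1' : x 1 < Real.pi * x 0) :
    ‖fderiv ℝ (cuspReflection γ) x‖ ^ p /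
        |LinearMap.det (fderiv ℝ (cuspReflection γ) x).toLinearMap| ≤
      Real.pi * (1 + (γ + 1) ^ 2 * Real.pi ^ 4 / (Real.pi - 1) ^ 4 +
          1 / (Real.pi - 1) ^ 2) ^ (p / 2) * x 0 ^ (-γ) := by
  have hpi : 3 < Real.pi := Real.pi_gt_three
  have hr0 : 0 < x 0 ^ γ := Real.rpow_pos_of_pos h0 γ
  have hr1 : x 0 ^ γ < 1 := Real.rpow_lt_one h0.le h0' hγ
  have hd : Real.pi - 1 ≤ Real.pi - x 0 ^ γ := by linarith
  have hd1 : 0 < Real.pi - 1 := by linarith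
  have hd0 : 0 < Real.pi - x 0 ^ γ := by linarith
  rw [(hasFDerivAt_cuspReflection_s8 h0 hd0.ne').fderiv, det_lowerShear]
  set a := γ * x 0 ^ (γ - 1) * (Real.pi * x 0 - x 1) * Real.pi / (Real.pi - x 0 ^ γ) ^ 2 +
    Real.pi * x 0 ^ γ / (Real.pi - x 0 ^ γ) with ha
  set b := -(x 0 ^ γ / (Real.pi - x 0 ^ γ)) with hb
  have hs : 0 ≤ Real.pi * x 0 - x 1 := by linarith
  have hrm : 0 < x 0 ^ (γ - 1) := Real.rpow_pos_of_pos h0 _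
  have ha0 : 0 ≤ a := by positivity
  have hmul : x 0 ^ (γ - 1) * x 0 = x 0 ^ γ := by
    rw [← Real.rpow_add_one h0.ne']; simp
  have ha1 : a ≤ (γ + 1) * Real.pi ^ 2 / (Real.pi - 1) ^ 2 := by
    have e : a = (γ * x 0 ^ (γ - 1) * (Real.pi * x 0 - x 1) * Real.pi +
        Real.pi * x 0 ^ γ * (Real.pi - x 0 ^ γ)) / (Real.pi - x 0 ^ γ) ^ 2 := by
      rw [ha]; field_simp
    rw [e]
    refine div_le_div₀ (by positivity) ?_ (by positivity) (by gcongr)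
    have t1 : x 0 ^ (γ - 1) * (Real.pi * x 0 - x 1) ≤ Real.pi := by
      have : x 0 ^ (γ - 1) * (Real.pi * x 0 - x 1) = Real.pi * x 0 ^ γ - x 0 ^ (γ - 1) * x 1 := by
        rw [← hmul]; ring
      have : 0 < x 0 ^ (γ - 1) * x 1 := by positivity
      nlinarith
    have t2 : x 0 ^ γ * (Real.pi - x 0 ^ γ) ≤ Real.pi := by nlinarith
    have t3 := mul_le_mul_of_nonneg_left t1 (by positivity : 0 ≤ γ * Real.pi)
    have t4 := mul_le_mul_of_nonneg_left t2 Real.pi_pos.le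
    linarith
  have ha2 : a ^ 2 ≤ (γ + 1) ^ 2 * Real.pi ^ 4 / (Real.pi - 1) ^ 4 := by
    calc a ^ 2 ≤ ((γ + 1) * Real.pi ^ 2 / (Real.pi - 1) ^ 2) ^ 2 := by gcongr
      _ = _ := by field_simp
  have hb2 : b ^ 2 ≤ 1 / (Real.pi - 1) ^ 2 := by
    calc b ^ 2 = (x 0 ^ γ / (Real.pi - x 0 ^ γ)) ^ 2 := by rw [hb]; ring
      _ ≤ (1 / (Real.pi - 1)) ^ 2 := by gcongr
      _ = _ := by field_simp
  have hnorm : ‖lowerShear a b‖ ^ p ≤ (1 + (γ + 1) ^ 2 * Real.pi ^ 4 / (Real.pi - 1) ^ 4 +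
          1 / (Real.pi - 1) ^ 2) ^ (p / 2) := by
    calc ‖lowerShear a b‖ ^ p ≤ √(1 + a ^ 2 + b ^ 2) ^ p := by
          gcongr; exact norm_lowerShear_le a b
      _ = (1 + a ^ 2 + b ^ 2) ^ (p / 2) := by
          rw [Real.sqrt_eq_rpow, ← Real.rpow_mul (by positivity)]
          congr 1; ring
      _ ≤ _ := by gcongr
  have hdet : |b|⁻¹ ≤ Real.pi * x 0 ^ (-γ) := by
    rw [hb, abs_neg, abs_of_pos (by positivity), inv_div, Real.rpow_neg h0.le, div_eq_mul_inv]
    gcongr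
    linarith
  calc ‖lowerShear a b‖ ^ p / |b| = ‖lowerShear a b‖ ^ p * |b|⁻¹ := div_eq_mul_inv _ _
    _ ≤ _ * (Real.pi * x 0 ^ (-γ)) := mul_le_mul hnorm hdet (by positivity) (by positivity)
    _ = _ := by ring

/-- The integral of `r ^ e` over the triangle `{(r, s) : 0 < r < 1, 0 < s < c r}` is
`c / (e + 2)` when `-2 < e`. -/
lemma lintegral_rpow_sector {c e : ℝ} (hc : 0 ≤ c) (he : -2 < e) :
    ∫⁻ x in {x : EuclideanSpace ℝ (Fin 2) | 0 < x 0 ∧ x 0 < 1 ∧ 0 < x 1 ∧ x 1 < c * x 0},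
      ENNReal.ofReal (x 0 ^ e) = ENNReal.ofReal (c / (e + 2)) := by
  have hmp := (volume_preserving_finTwoArrow ℝ).comp
    (EuclideanSpace.volume_preserving_symm_measurableEquiv_toLp (Fin 2))
  set T : Set (ℝ × ℝ) := {q | 0 < q.1 ∧ q.1 < 1 ∧ 0 < q.2 ∧ q.2 < c * q.1}
  have hT : MeasurableSet T := by
    measurability
  have hg : Measurable fun q : ℝ × ℝ => ENNReal.ofReal (q.1 ^ e) := by fun_prop
  have key := hmp.setLIntegral_comp_preimage hT hg
  refine Eq.trans key ?_
  rw [← lintegral_indicator hT, Measure.volume_eq_prod,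
    lintegral_prod _ (hg.indicator hT).aemeasurable]
  have inner : ∀ r : ℝ, ∫⁻ s, T.indicator (fun q : ℝ × ℝ => ENNReal.ofReal (q.1 ^ e)) (r, s) =
      (Set.Ioo 0 1).indicator (fun r => ENNReal.ofReal (c * r ^ (e + 1))) r := by
    intro r
    by_cases hr : r ∈ Set.Ioo (0 : ℝ) 1
    · have : ∀ s, T.indicator (fun q : ℝ × ℝ => ENNReal.ofReal (q.1 ^ e)) (r, s) =
          (Set.Ioo 0 (c * r)).indicator (fun _ => ENNReal.ofReal (r ^ e)) s := by
        intro s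
        simp [Set.indicator, T, hr.1, hr.2]
      simp_rw [this]
      rw [lintegral_indicator measurableSet_Ioo, setLIntegral_const, Real.volume_Ioo, sub_zero,
        Set.indicator_of_mem hr, ← ENNReal.ofReal_mul (Real.rpow_nonneg hr.1.le _),
        Real.rpow_add_one hr.1.ne']
      congr 1; ring
    · have : ∀ s, T.indicator (fun q : ℝ × ℝ => ENNReal.ofReal (q.1 ^ e)) (r, s) = 0 :=
        fun s => Set.indicator_of_notMem (fun h => hr ⟨h.1, h.2.1⟩) _
      simp [this, hr]
  simp_rw [inner]
  rw [lintegral_indicator measurableSet_Ioo, ← ofReal_integral_eq_lintegral_ofReal,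
    ← integral_Ioc_eq_integral_Ioo, ← intervalIntegral.integral_of_le zero_le_one,
    intervalIntegral.integral_const_mul, integral_rpow (Or.inl (by linarith))]
  · congr 1
    rw [Real.zero_rpow (by linarith), Real.one_rpow]
    ring
  · exact ((intervalIntegrable_iff_integrableOn_Ioo_of_le zero_le_one).1
      (intervalIntegral.intervalIntegrable_rpow' (by linarith))).const_mul c
  · filter_upwards [ae_restrict_mem measurableSet_Ioo] with r hr
    have := Real.rpow_nonneg hr.1.le (e + 1)
    positivity

/-- Let `γ > 0`, `p ≥ 1` and `1/p ≤ α < 2/(γ+2)`. Then the `(p, αp)`-dilatation integrand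
of the cuspidal reflection is integrable over `U = {(r,s) : 0 < r < 1, 0 < s < π r}` and
`∫∫_U (‖DΦ‖^p/|det DΦ|)^{α/(1−α)} ≤ π C_γ^{α/(1−α)} (1−α)/(2(1−α) − αγ) < ∞`, where
`C_γ = π (1 + (γ+1)² π⁴/(π−1)⁴ + 1/(π−1)²)^{p/2}`. -/
theorem cusp_reflection_dilatation_integrable (γ p α : ℝ) (hγ : 0 < γ) (hp : 1 ≤ p)
    (hα1 : 1 / p ≤ α) (hα2 : α < 2 / (γ + 2)) :
    IntegrableOn
      (fun x : EuclideanSpace ℝ (Fin 2) =>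
        (‖fderiv ℝ (cuspReflection γ) x‖ ^ p /
          |LinearMap.det (fderiv ℝ (cuspReflection γ) x).toLinearMap|) ^ (α / (1 - α)))
      {x : EuclideanSpace ℝ (Fin 2) | 0 < x 0 ∧ x 0 < 1 ∧ 0 < x 1 ∧ x 1 < Real.pi * x 0}
      volume ∧
    ∫ x in {x : EuclideanSpace ℝ (Fin 2) | 0 < x 0 ∧ x 0 < 1 ∧ 0 < x 1 ∧ x 1 < Real.pi * x 0},
        (‖fderiv ℝ (cuspReflection γ) x‖ ^ p /
          |LinearMap.det (fderiv ℝ (cuspReflection γ) x).toLinearMap|) ^ (α / (1 - α)) ≤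
      Real.pi * (Real.pi * (1 + (γ + 1) ^ 2 * Real.pi ^ 4 / (Real.pi - 1) ^ 4 +
          1 / (Real.pi - 1) ^ 2) ^ (p / 2)) ^ (α / (1 - α)) *
        (1 - α) / (2 * (1 - α) - α * γ) := by
  set U := {x : EuclideanSpace ℝ (Fin 2) | 0 < x 0 ∧ x 0 < 1 ∧ 0 < x 1 ∧ x 1 < Real.pi * x 0}
  set C := Real.pi * (1 + (γ + 1) ^ 2 * Real.pi ^ 4 / (Real.pi - 1) ^ 4 +
          1 / (Real.pi - 1) ^ 2) ^ (p / 2)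
  set f := fun x : EuclideanSpace ℝ (Fin 2) => (‖fderiv ℝ (cuspReflection γ) x‖ ^ p /
    |LinearMap.det (fderiv ℝ (cuspReflection γ) x).toLinearMap|) ^ (α / (1 - α))
  have hpi : 0 < Real.pi := Real.pi_pos
  have hα0 : 0 < α := lt_of_lt_of_le (by positivity) hα1
  have hαγ : α * (γ + 2) < 2 := (lt_div_iff₀ (by positivity)).1 hα2
  have hα : 0 < 1 - α := by nlinarith
  have hβ : 0 < α / (1 - α) := by positivity
  have hden : 0 < 2 * (1 - α) - α * γ := by linarith
  have hC0 : 0 ≤ C := by positivity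
  have he : -γ * (α / (1 - α)) + 2 = (2 * (1 - α) - α * γ) / (1 - α) := by field_simp; ring
  have he2 : -2 < -γ * (α / (1 - α)) := by
    have : 0 < (2 * (1 - α) - α * γ) / (1 - α) := by positivity
    linarith
  have hUm : MeasurableSet U := by
    measurability
  have hfm : Measurable f := by
    have hd : Measurable (fderiv ℝ (cuspReflection γ)) := measurable_fderiv ℝ _
    have hdet : Measurable fun x => (fderiv ℝ (cuspReflection γ) x).det :=
      ContinuousLinearMap.continuous_det.measurable.comp hd
    exact ((hd.norm.pow_const p).div hdet.abs).pow_const _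
  have hf0 : ∀ x, 0 ≤ f x := fun x => by positivity
  have hfle : ∀ x ∈ U, f x ≤ C ^ (α / (1 - α)) * x 0 ^ (-γ * (α / (1 - α))) := by
    intro x hx
    rw [Real.rpow_mul hx.1.le, ← Real.mul_rpow hC0 (Real.rpow_nonneg hx.1.le _)]
    exact Real.rpow_le_rpow (by positivity)
      (dilatation_cuspReflection_le hγ (by linarith) hx.1 hx.2.1 hx.2.2.1 hx.2.2.2) hβ.le
  have hle : ∫⁻ x in U, ENNReal.ofReal (f x) ≤
      ENNReal.ofReal (Real.pi * C ^ (α / (1 - α)) * (1 - α) / (2 * (1 - α) - α * γ)) := by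
    calc ∫⁻ x in U, ENNReal.ofReal (f x)
        ≤ ∫⁻ x in U, ENNReal.ofReal (C ^ (α / (1 - α))) *
            ENNReal.ofReal (x 0 ^ (-γ * (α / (1 - α)))) := by
          refine setLIntegral_mono' hUm fun x hx => ?_
          rw [← ENNReal.ofReal_mul (by positivity)]
          exact ENNReal.ofReal_le_ofReal (hfle x hx)
      _ = _ := by
          rw [lintegral_const_mul' _ _ ENNReal.ofReal_ne_top, lintegral_rpow_sector hpi.le he2,
            ← ENNReal.ofReal_mul (by positivity), he]
          congr 1
          field_simp
  refine ⟨⟨hfm.aestronglyMeasurable, ?_⟩, ?_⟩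
  · rw [hasFiniteIntegral_iff_ofReal (Filter.Eventually.of_forall hf0)]
    exact hle.trans_lt ENNReal.ofReal_lt_top
  · rw [integral_eq_lintegral_of_nonneg_ae (Filter.Eventually.of_forall hf0)
      hfm.aestronglyMeasurable]
    exact ENNReal.toReal_le_of_le_ofReal (by positivity) hle
end

section
/- Let n ≥ 2 and let α₁, …, αₙ be real numbers with α = α₁ + ⋯ + αₙ. Define φ : ℝⁿ → ℝⁿ by φ(x)ᵢ = xᵢ |x|^{αᵢ} for x ≠ 0 and φ(0) = 0. Then for every x ≠ 0 the Jacobian determinant of φ at x equals J(x,φ) = det Dφ(x) = |x|^{α} ( 1 + Σᵢ₌₁ⁿ αᵢ xᵢ² / |x|² ). -/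
/-- The generalized radial stretch mapping `φ(x)ᵢ = xᵢ |x|^{αᵢ}` (with `φ(0) = 0`). -/
noncomputable def radialStretch (n : ℕ) (α : Fin n → ℝ) :
    EuclideanSpace ℝ (Fin n) → EuclideanSpace ℝ (Fin n) := fun x =>
  (WithLp.equiv 2 (Fin n → ℝ)).symm fun i => x i * ‖x‖ ^ α i

theorem hasFDerivAt_norm_rpow_of_ne_zero {E : Type*} [NormedAddCommGroup E]
    [InnerProductSpace ℝ E] {x : E} (hx : x ≠ 0) (p : ℝ) :
    HasFDerivAt (fun y : E => ‖y‖ ^ p) ((p * ‖x‖ ^ (p - 2)) • innerSL ℝ x) x := by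
  apply HasStrictFDerivAt.hasFDerivAt
  convert! (hasStrictFDerivAt_norm_sq x).rpow_const (p := p / 2) (by simp [hx]) using 0
  simp_rw [← Real.rpow_natCast_mul (norm_nonneg _), ← Nat.cast_smul_eq_nsmul ℝ, smul_smul]
  ring_nf

theorem hasFDerivAt_radialStretch {n : ℕ} (α : Fin n → ℝ) {x : EuclideanSpace ℝ (Fin n)}
    (hx : x ≠ 0) :
    HasFDerivAt (radialStretch n α)
      ((EuclideanSpace.equiv (Fin n) ℝ).symm.toContinuousLinearMap ∘L
        ContinuousLinearMap.pi fun i =>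
          x i • ((α i * ‖x‖ ^ (α i - 2)) • innerSL ℝ x) +
            ‖x‖ ^ α i • EuclideanSpace.proj i) x := by
  rw [← hasFDerivWithinAt_univ, hasFDerivWithinAt_euclidean]
  intro i
  exact ((EuclideanSpace.proj (𝕜 := ℝ) i).hasFDerivAt.mul
    (hasFDerivAt_norm_rpow_of_ne_zero hx (α i))).hasFDerivWithinAt

/-- The Jacobian matrix of the radial stretch is the diagonal matrix with entries `‖x‖ ^ α i`
times a rank-one perturbation of the identity. -/
theorem toMatrix_fderiv_radialStretch {n : ℕ} (α : Fin n → ℝ) {x : EuclideanSpace ℝ (Fin n)}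
    (hx : x ≠ 0) :
    LinearMap.toMatrix (EuclideanSpace.basisFun (Fin n) ℝ).toBasis
        (EuclideanSpace.basisFun (Fin n) ℝ).toBasis
        (fderiv ℝ (radialStretch n α) x).toLinearMap =
      Matrix.of fun i j => ‖x‖ ^ α i *
        (1 + Matrix.replicateCol Unit (fun k => α k * x k / ‖x‖ ^ 2) *
          Matrix.replicateRow Unit x : Matrix (Fin n) (Fin n) ℝ) i j := by
  have hpos : 0 < ‖x‖ := norm_pos_iff.mpr hx
  ext i j
  rw [(hasFDerivAt_radialStretch α hx).fderiv]
  have hpow : ‖x‖ ^ (α i - 2) = ‖x‖ ^ α i / ‖x‖ ^ 2 := by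
    exact_mod_cast Real.rpow_sub hpos (α i) 2
  simp [LinearMap.toMatrix_apply, Matrix.mul_apply, Matrix.one_apply, hpow,
    EuclideanSpace.inner_single_right, mul_add]
  ring

/-- Let `n ≥ 2` and `α₁, …, αₙ` be real with sum `α`. For every `x ≠ 0` the Jacobian
determinant of the generalized radial stretch `φ` equals
`J(x,φ) = |x|^{α}(1 + Σᵢ αᵢ xᵢ²/|x|²)`. -/
theorem radialStretch_jacobian_det (n : ℕ) (hn : 2 ≤ n) (α : Fin n → ℝ)
    (x : EuclideanSpace ℝ (Fin n)) (hx : x ≠ 0) :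
    LinearMap.det (fderiv ℝ (radialStretch n α) x).toLinearMap =
      ‖x‖ ^ (∑ i, α i) * (1 + ∑ i, α i * x i ^ 2 / ‖x‖ ^ 2) := by
  rw [← LinearMap.det_toMatrix (EuclideanSpace.basisFun (Fin n) ℝ).toBasis,
    toMatrix_fderiv_radialStretch α hx, Matrix.det_mul_column,
    Matrix.det_one_add_replicateCol_mul_replicateRow, Real.rpow_sum_of_pos (norm_pos_iff.mpr hx)]
  congr 2
  refine Finset.sum_congr rfl fun i _ => ?_
  ring
end
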